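/- arXiv:1106.2839 — 2 statements merged into one kernel-verified Lean document; each statement's English description precedes it below -/
import Mathlib

section
/- Let w ∈ S_N. If some N-occurrence {a, N, b, c} of the pattern 3412 in w (with a, b, c the letters playing the roles of 3, 1, 2 respectively, and N playing the role of 4) satisfies c ∉ {m_k : k ∈ newrep(w)}, then w has an N-occurrence of at least one of the patterns 45231 and 45132. -/
/-!
Common framework.  Permutations of `{1, …, m}` are modelled as `Equiv.Perm (Fin m)`
with 0-based positions and values.  The simple reflection `sr m i` (for
`0 ≤ i ≤ m - 2`, corresponding to the paper's `s_{i+1}`) swaps the values `i` and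
`i + 1`.  Cut statistics `Mstat w k` / `mstat w k` (the paper's `M_{k+1}`/`m_{k+1}`)
are respectively the maximum of the first `k + 1` entries and the minimum of the
remaining entries of the one-line notation of `w`.
-/

/-- The simple reflection swapping `i` and `i + 1` (0-based) in the symmetric group
on `Fin m`; the identity if out of range. -/
def sr (m i : ℕ) : Equiv.Perm (Fin m) :=
  if h : i + 1 < m then Equiv.swap ⟨i, Nat.lt_of_succ_lt h⟩ ⟨i + 1, h⟩ else 1

/-- `l` is a word in the simple reflections whose product is `w`. -/
def IsWord (m : ℕ) (l : List ℕ) (w : Equiv.Perm (Fin m)) : Prop :=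
  (∀ i ∈ l, i + 1 < m) ∧ (l.map (sr m)).prod = w

/-- The Coxeter length `ℓ(w)`: the minimal length of a word expressing `w`. -/
noncomputable def len {m : ℕ} (w : Equiv.Perm (Fin m)) : ℕ :=
  sInf {c | ∃ l : List ℕ, IsWord m l w ∧ l.length = c}

/-- `l` is a reduced decomposition of `w`. -/
def IsReducedWord {m : ℕ} (w : Equiv.Perm (Fin m)) (l : List ℕ) : Prop :=
  IsWord m l w ∧ l.length = len w

/-- The support of `w`: the letters appearing in some reduced decomposition. -/
noncomputable def supp {m : ℕ} (w : Equiv.Perm (Fin m)) : Set ℕ :=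
  {i | ∃ l : List ℕ, IsReducedWord w l ∧ i ∈ l}

/-- `rep w = ℓ(w) - |supp w|`, the number of repeated letters. -/
noncomputable def rep {m : ℕ} (w : Equiv.Perm (Fin m)) : ℕ :=
  len w - (supp w).ncard

/-- The value of `w` at the (0-based) position `i`, as a natural number. -/
def valAt {m : ℕ} (w : Equiv.Perm (Fin m)) (i : ℕ) : ℕ :=
  if h : i < m then (w ⟨i, h⟩ : ℕ) else 0

/-- The (0-based) position at which the value `v` occurs in `w`. -/
def posOf {m : ℕ} (w : Equiv.Perm (Fin m)) (v : ℕ) : ℕ :=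
  if h : v < m then (w⁻¹ ⟨v, h⟩ : ℕ) else 0

/-- `Mstat w k`: the maximum of the first `k + 1` entries of `w`. -/
noncomputable def Mstat {m : ℕ} (w : Equiv.Perm (Fin m)) (k : ℕ) : ℕ :=
  sSup {v | ∃ i : Fin m, (i : ℕ) ≤ k ∧ (w i : ℕ) = v}

/-- `mstat w k`: the minimum of the entries of `w` in positions `> k`. -/
noncomputable def mstat {m : ℕ} (w : Equiv.Perm (Fin m)) (k : ℕ) : ℕ :=
  sInf {v | ∃ i : Fin m, k < (i : ℕ) ∧ (w i : ℕ) = v}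

/-- `wbar` is obtained from `w` by deleting the largest letter from the one-line
notation of `w` and sliding all subsequent letters one space to the left. -/
def IsDeletion {n : ℕ} (w : Equiv.Perm (Fin (n + 1))) (wbar : Equiv.Perm (Fin n)) : Prop :=
  ∀ i : Fin n, (wbar i : ℕ) =
    if (i : ℕ) < posOf w n then valAt w (i : ℕ) else valAt w ((i : ℕ) + 1)

/-- `newrep w wbar`: the letters `k` with `s_k ∈ supp(wbar)` and `w⁻¹(top) ≤ k`. -/
noncomputable def newrep {n : ℕ} (w : Equiv.Perm (Fin (n + 1))) (wbar : Equiv.Perm (Fin n)) :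
    Set ℕ :=
  {k | k ∈ supp wbar ∧ posOf w n ≤ k}

/-- An occurrence of the pattern `p` in `w`, recorded by its set `S` of values:
there are positions `f 0 < f 1 < ⋯` whose values are in the same relative order
as `p`, and `S` is the corresponding set of values. -/
def IsOccSet {m c : ℕ} (p : Fin c → ℕ) (w : Equiv.Perm (Fin m)) (S : Finset ℕ) : Prop :=
  ∃ f : Fin c → Fin m, StrictMono f ∧ (∀ a b : Fin c, p a < p b ↔ w (f a) < w (f b)) ∧
    S = Finset.image (fun a => (w (f a) : ℕ)) Finset.univ

/-- An `N`-occurrence (here `N = n`, the largest 0-based value): an occurrence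
whose largest letter is the largest value of `w`. -/
def IsTopOccSet {n c : ℕ} (p : Fin c → ℕ) (w : Equiv.Perm (Fin (n + 1))) (S : Finset ℕ) : Prop :=
  IsOccSet p w S ∧ n ∈ S

/-- The number of occurrences of the pattern `p` in `w`. -/
noncomputable def occCount {m c : ℕ} (p : Fin c → ℕ) (w : Equiv.Perm (Fin m)) : ℕ :=
  Set.ncard {S : Finset ℕ | IsOccSet p w S}

/-- The number of `N`-occurrences of the pattern `p` in `w`. -/
noncomputable def topOccCount {n c : ℕ} (p : Fin c → ℕ) (w : Equiv.Perm (Fin (n + 1))) : ℕ :=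
  Set.ncard {S : Finset ℕ | IsTopOccSet p w S}

def p321 : Fin 3 → ℕ := ![3, 2, 1]
def p3412 : Fin 4 → ℕ := ![3, 4, 1, 2]
def p4321 : Fin 4 → ℕ := ![4, 3, 2, 1]
def p34512 : Fin 5 → ℕ := ![3, 4, 5, 1, 2]
def p45123 : Fin 5 → ℕ := ![4, 5, 1, 2, 3]
def p35412 : Fin 5 → ℕ := ![3, 5, 4, 1, 2]
def p43512 : Fin 5 → ℕ := ![4, 3, 5, 1, 2]
def p45132 : Fin 5 → ℕ := ![4, 5, 1, 3, 2]
def p45213 : Fin 5 → ℕ := ![4, 5, 2, 1, 3]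
def p53412 : Fin 5 → ℕ := ![5, 3, 4, 1, 2]
def p45312 : Fin 5 → ℕ := ![4, 5, 3, 1, 2]
def p45231 : Fin 5 → ℕ := ![4, 5, 2, 3, 1]

/-- The pattern `𝔭_k(w)` of Definition 4.4, recorded as its set of values:
(I) if `w⁻¹(top)` is left of `w⁻¹(M_k)`, the 321-occurrence `{top, M_k, m_k}`;
(II) else if `wbar(k) > m_k`, the 321-occurrence `{top, wbar(k), m_k}`;
(III) otherwise the 3412-occurrence `{M_k, top, wbar(k), m_k}`. -/
noncomputable def pocc {n : ℕ} (w : Equiv.Perm (Fin (n + 1))) (wbar : Equiv.Perm (Fin n))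
    (k : ℕ) : Finset ℕ :=
  if posOf w n < posOf w (Mstat wbar k) then {n, Mstat wbar k, mstat wbar k}
  else if mstat wbar k < valAt wbar k then {n, valAt wbar k, mstat wbar k}
  else {Mstat wbar k, n, valAt wbar k, mstat wbar k}

theorem exists_isWord {m : ℕ} (w : Equiv.Perm (Fin m)) : ∃ l : List ℕ, IsWord m l w := by
  cases m with
  | zero => exact ⟨[], by simp, Subsingleton.elim _ _⟩
  | succ n =>
    have hw : w ∈ Submonoid.closure
        (Set.range fun i : Fin n ↦ Equiv.swap i.castSucc i.succ) := by
      rw [Equiv.Perm.mclosure_swap_castSucc_succ]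
      exact Submonoid.mem_top w
    induction hw using Submonoid.closure_induction with
    | mem x hx =>
      obtain ⟨i, rfl⟩ := hx
      refine ⟨[i], by simp, ?_⟩
      simp [sr, Fin.castSucc, Fin.succ, Fin.castAdd, Fin.castLE]
    | one => exact ⟨[], by simp, by simp⟩
    | mul x y _ _ hx hy =>
      obtain ⟨l, hl, rfl⟩ := hx
      obtain ⟨l', hl', rfl⟩ := hy
      refine ⟨l ++ l', fun i hi ↦ ?_, by simp⟩
      exact (List.mem_append.mp hi).elim (hl i) (hl' i)

theorem exists_isReducedWord {m : ℕ} (w : Equiv.Perm (Fin m)) :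
    ∃ l : List ℕ, IsReducedWord w l := by
  obtain ⟨l, hl⟩ := exists_isWord w
  exact Nat.sInf_mem (s := {c | ∃ l : List ℕ, IsWord m l w ∧ l.length = c}) ⟨_, l, hl, rfl⟩

theorem sr_apply_le_iff {m i k : ℕ} (hik : i ≠ k) (x : Fin m) :
    (sr m i x : ℕ) ≤ k ↔ (x : ℕ) ≤ k := by
  unfold sr
  split_ifs with h
  · rw [Equiv.swap_apply_def]
    split_ifs with h1 h2 <;> simp_all <;> omega
  · simp

theorem prod_sr_apply_le_iff {m k : ℕ} {l : List ℕ} (hk : k ∉ l) (x : Fin m) :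
    ((l.map (sr m)).prod x : ℕ) ≤ k ↔ (x : ℕ) ≤ k := by
  induction l with
  | nil => simp
  | cons i l ih =>
    simp only [List.mem_cons, not_or] at hk
    rw [List.map_cons, List.prod_cons, Equiv.Perm.mul_apply, sr_apply_le_iff (Ne.symm hk.1),
      ih hk.2]

/-- An inversion of `w` across the cut after position `k` forces `s_k` into the support. -/
theorem mem_supp_of_inversion {m k : ℕ} {w : Equiv.Perm (Fin m)} {i j : Fin m}
    (hi : (i : ℕ) ≤ k) (hj : k < j) (h : w j < w i) : k ∈ supp w := by
  obtain ⟨l, hl⟩ := exists_isReducedWord w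
  refine ⟨l, hl, ?_⟩
  by_contra hk
  have hpres := prod_sr_apply_le_iff (m := m) hk
  rw [hl.1.2] at hpres
  have hwi := (hpres i).mpr hi
  have hwj := (hpres j).not.mpr (by omega)
  have := Fin.lt_def.mp h
  omega

theorem exists_lt_of_ne_mstat {m k : ℕ} {w : Equiv.Perm (Fin m)} {i : Fin m} (hi : k < i)
    (h : (w i : ℕ) ≠ mstat w k) : ∃ j : Fin m, k < j ∧ w j < w i := by
  have hmem : (w i : ℕ) ∈ {v | ∃ i : Fin m, k < (i : ℕ) ∧ (w i : ℕ) = v} := ⟨i, hi, rfl⟩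
  obtain ⟨j, hj, hjv⟩ := Nat.sInf_mem ⟨_, hmem⟩
  have hle := Nat.sInf_le hmem
  refine ⟨j, hj, Fin.lt_def.mpr ?_⟩
  unfold mstat at h
  omega

theorem IsDeletion.apply_of_lt {n : ℕ} {w : Equiv.Perm (Fin (n + 1))} {wbar : Equiv.Perm (Fin n)}
    (hdel : IsDeletion w wbar) {i : Fin n} (hi : (i : ℕ) < posOf w n) :
    (wbar i : ℕ) = w i.castSucc := by
  rw [hdel i, if_pos hi, valAt, dif_pos (by omega)]
  rfl

theorem IsDeletion.apply_of_le {n : ℕ} {w : Equiv.Perm (Fin (n + 1))} {wbar : Equiv.Perm (Fin n)}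
    (hdel : IsDeletion w wbar) {i : Fin n} (hi : posOf w n ≤ i) :
    (wbar i : ℕ) = w i.succ := by
  rw [hdel i, if_neg (by omega), valAt, dif_pos (by omega)]
  rfl

theorem posOf_eq_of_apply_eq_last {n : ℕ} {w : Equiv.Perm (Fin (n + 1))} {i : Fin (n + 1)}
    (h : w i = Fin.last n) : posOf w n = i := by
  rw [posOf, dif_pos (Nat.lt_succ_self n)]
  exact congrArg Fin.val (Equiv.Perm.inv_eq_iff_eq.mpr h.symm)

theorem strictMono_vecCons₅ {α : Type*} [Preorder α] {a b c d e : α}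
    (hab : a < b) (hbc : b < c) (hcd : c < d) (hde : d < e) : StrictMono ![a, b, c, d, e] := by
  rw [Fin.strictMono_iff_lt_succ]
  intro i
  fin_cases i <;> assumption

/-- if some `N`-occurrence `{a, N, b, c}` of 3412 in `w` (at positions
`i1 < i2 < i3 < i4`, with `a = w i1`, `b = w i3`, `c = w i4`) has
`c ∉ {m_k : k ∈ newrep(w)}`, then `w` has an `N`-occurrence of 45231 or of 45132. -/
theorem occ3412_must_use_mstat {n : ℕ} (w : Equiv.Perm (Fin (n + 1)))
    (wbar : Equiv.Perm (Fin n)) (hdel : IsDeletion w wbar)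
    (i1 i2 i3 i4 : Fin (n + 1)) (h12 : i1 < i2) (h23 : i2 < i3) (h34 : i3 < i4)
    (htop : w i2 = Fin.last n)
    (ho1 : w i3 < w i4) (ho2 : w i4 < w i1) (ho3 : w i1 < w i2)
    (hc : ¬ ∃ k ∈ newrep w wbar, (w i4 : ℕ) = mstat wbar k) :
    (∃ S : Finset ℕ, IsTopOccSet p45231 w S) ∨ (∃ S : Finset ℕ, IsTopOccSet p45132 w S) := by
  have hpos : posOf w n = i2 := posOf_eq_of_apply_eq_last htop
  simp only [Fin.lt_def] at *
  let j1 : Fin n := ⟨i1, by omega⟩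
  let j4 : Fin n := ⟨i4 - 1, by omega⟩
  have hj1 : (wbar j1 : ℕ) = w i1 := hdel.apply_of_lt (by simp only [j1]; omega)
  have hs4 : j4.succ = i4 := Fin.ext (by simp only [j4, Fin.val_succ]; omega)
  have hj4 : (wbar j4 : ℕ) = w i4 := by
    rw [hdel.apply_of_le (by simp only [j4]; omega), hs4]
  have hsupp : (i4 - 2 : ℕ) ∈ supp wbar :=
    mem_supp_of_inversion (i := j1) (j := j4) (by simp only [j1]; omega)
      (by simp only [j4]; omega) (by rw [Fin.lt_def]; omega)
  have hne : (wbar j4 : ℕ) ≠ mstat wbar (i4 - 2) := fun h ↦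
    hc ⟨_, ⟨hsupp, by omega⟩, hj4 ▸ h⟩
  obtain ⟨j, hkj, hlt⟩ := exists_lt_of_ne_mstat (by simp only [j4]; omega) hne
  have hj : (wbar j : ℕ) = w j.succ := hdel.apply_of_le (by omega)
  have hj_ne : (j : ℕ) ≠ j4 := fun h ↦ by
    rw [Fin.ext h] at hlt
    exact lt_irrefl _ hlt
  have h4j : i4 < j.succ := by
    simp only [j4] at hj_ne
    rw [Fin.lt_def, Fin.val_succ]
    omega
  have hd : (w j.succ : ℕ) < w i4 := by rw [Fin.lt_def] at hlt; omega
  have hmono : StrictMono ![i1, i2, i3, i4, j.succ] := strictMono_vecCons₅ h12 h23 h34 h4j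
  have hmem : n ∈ Finset.univ.image
      (fun a ↦ (w (![i1, i2, i3, i4, j.succ] a) : ℕ)) :=
    Finset.mem_image.mpr ⟨1, Finset.mem_univ _, by simp [htop]⟩
  have hne3 : (w j.succ : ℕ) ≠ w i3 := fun h ↦ by
    have := w.injective (Fin.ext h)
    rw [this, Fin.lt_def] at h4j
    omega
  rcases lt_or_gt_of_ne hne3 with h | h
  · refine Or.inl ⟨_, ⟨_, hmono, fun a b ↦ ?_, rfl⟩, hmem⟩
    fin_cases a <;> fin_cases b <;> simp [p45231] <;> omega
  · refine Or.inr ⟨_, ⟨_, hmono, fun a b ↦ ?_, rfl⟩, hmem⟩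
    fin_cases a <;> fin_cases b <;> simp [p45132] <;> omega
end

section
/- Let w ∈ S_N and let Φ = {4321, 34512, 45123, 35412, 43512, 45132, 45213, 53412, 45312, 45231}. If w has no N-occurrence of any of the patterns in Φ, then |newrep(w)| = [321;3412]_N(w); if w has an N-occurrence of at least one pattern in Φ, then |newrep(w)| < [321;3412]_N(w). -/
/-- `w` has an `N`-occurrence of some pattern in
`Φ = {4321, 34512, 45123, 35412, 43512, 45132, 45213, 53412, 45312, 45231}`. -/
def HasTopPhiOcc {n : ℕ} (w : Equiv.Perm (Fin (n + 1))) : Prop :=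
  (∃ S : Finset ℕ, IsTopOccSet p4321 w S) ∨ (∃ S : Finset ℕ, IsTopOccSet p34512 w S) ∨
  (∃ S : Finset ℕ, IsTopOccSet p45123 w S) ∨ (∃ S : Finset ℕ, IsTopOccSet p35412 w S) ∨
  (∃ S : Finset ℕ, IsTopOccSet p43512 w S) ∨ (∃ S : Finset ℕ, IsTopOccSet p45132 w S) ∨
  (∃ S : Finset ℕ, IsTopOccSet p45213 w S) ∨ (∃ S : Finset ℕ, IsTopOccSet p53412 w S) ∨
  (∃ S : Finset ℕ, IsTopOccSet p45312 w S) ∨ (∃ S : Finset ℕ, IsTopOccSet p45231 w S)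

/-- The inversions of `u`, as pairs of positions. -/
def inversions {m : ℕ} (u : Equiv.Perm (Fin m)) : Finset (Fin m × Fin m) :=
  {q | q.1 < q.2 ∧ u q.2 < u q.1}

theorem mem_inversions {m : ℕ} {u : Equiv.Perm (Fin m)} {q : Fin m × Fin m} :
    q ∈ inversions u ↔ q.1 < q.2 ∧ u q.2 < u q.1 := by
  simp [inversions]

theorem inversions_one {m : ℕ} : inversions (1 : Equiv.Perm (Fin m)) = ∅ := by
  ext q
  simpa [mem_inversions] using fun h => h.le

theorem sr_mul_self (m i : ℕ) : sr m i * sr m i = 1 := by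
  unfold sr
  split_ifs <;> simp

theorem sr_sr (m i : ℕ) (c : Fin m) : sr m i (sr m i c) = c := by
  rw [← Equiv.Perm.mul_apply, sr_mul_self, Equiv.Perm.one_apply]

theorem val_sr {m i : ℕ} (hi : i + 1 < m) (c : Fin m) :
    (sr m i c : ℕ) = if (c : ℕ) = i then i + 1 else if (c : ℕ) = i + 1 then i else c := by
  unfold sr
  rw [dif_pos hi, Equiv.swap_apply_def]
  simp only [Fin.ext_iff]
  split_ifs <;> simp_all

theorem card_inversions_mul_sr {m i : ℕ} (hi : i + 1 < m) (u : Equiv.Perm (Fin m))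
    (hu : u ⟨i, by omega⟩ < u ⟨i + 1, hi⟩) :
    (inversions (u * sr m i)).card = (inversions u).card + 1 := by
  have key : inversions (u * sr m i) =
      insert (⟨i, by omega⟩, ⟨i + 1, hi⟩)
        ((inversions u).image fun q => (sr m i q.1, sr m i q.2)) := by
    have e₁ : sr m i ⟨i, by omega⟩ = ⟨i + 1, hi⟩ := by ext; simp [val_sr hi]
    have e₂ : sr m i ⟨i + 1, hi⟩ = ⟨i, by omega⟩ := by ext; simp [val_sr hi]
    have mono : ∀ a b : Fin m, a < b → ¬ ((a : ℕ) = i ∧ (b : ℕ) = i + 1) →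
        sr m i a < sr m i b := by
      intro a b hab hne
      rw [Fin.lt_def] at hab ⊢
      rw [val_sr hi, val_sr hi]
      split_ifs <;> omega
    ext ⟨a, b⟩
    simp only [mem_inversions, Finset.mem_insert,
      Finset.mem_image, Prod.exists, Prod.mk.injEq, Equiv.Perm.mul_apply]
    constructor
    · rintro ⟨hab, hlt⟩
      by_cases hc : (a : ℕ) = i ∧ (b : ℕ) = i + 1
      · exact Or.inl ⟨Fin.ext hc.1, Fin.ext hc.2⟩
      · exact Or.inr ⟨_, _, ⟨mono a b hab hc, hlt⟩, sr_sr _ _ _, sr_sr _ _ _⟩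
    · rintro (⟨rfl, rfl⟩ | ⟨c, d, ⟨hcd, hlt⟩, rfl, rfl⟩)
      · rw [e₁, e₂]
        exact ⟨by simp, hu⟩
      · rw [sr_sr, sr_sr]
        refine ⟨mono c d hcd ?_, hlt⟩
        rintro ⟨hc, hd⟩
        have hc' : c = ⟨i, by omega⟩ := Fin.ext hc
        have hd' : d = ⟨i + 1, hi⟩ := Fin.ext hd
        exact absurd hu (hc' ▸ hd' ▸ hlt.asymm)
  rw [key, Finset.card_insert_of_notMem, Finset.card_image_of_injective]
  · rintro ⟨a, b⟩ ⟨c, d⟩ h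
    simpa using h
  · simp only [mem_inversions, Finset.mem_image, Prod.exists, Prod.mk.injEq, not_exists, not_and,
      and_imp]
    intro a b hab _ h₁ h₂
    have h₃ := congrArg Fin.val h₁
    have h₄ := congrArg Fin.val h₂
    rw [Fin.lt_def] at hab
    rw [val_sr hi] at h₃ h₄
    simp only at h₃ h₄
    split_ifs at h₃ h₄ <;> omega

theorem card_inversions_mul_sr_of_descent {m i : ℕ} (hi : i + 1 < m) (u : Equiv.Perm (Fin m))
    (hu : u ⟨i + 1, hi⟩ < u ⟨i, by omega⟩) :
    (inversions u).card = (inversions (u * sr m i)).card + 1 := by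
  have h := card_inversions_mul_sr hi (u * sr m i) (by
    have e₁ : sr m i ⟨i, by omega⟩ = ⟨i + 1, hi⟩ := by ext; simp [val_sr hi]
    have e₂ : sr m i ⟨i + 1, hi⟩ = ⟨i, by omega⟩ := by ext; simp [val_sr hi]
    rwa [Equiv.Perm.mul_apply, Equiv.Perm.mul_apply, e₁, e₂])
  rwa [mul_assoc, sr_mul_self, mul_one] at h

theorem eq_one_of_no_descent {m : ℕ} (u : Equiv.Perm (Fin m))
    (h : ∀ i (hi : i + 1 < m), u ⟨i, by omega⟩ ≤ u ⟨i + 1, hi⟩) : u = 1 := by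
  cases m with
  | zero => exact Subsingleton.elim _ _
  | succ m =>
    have hm : StrictMono u := Fin.strictMono_iff_lt_succ.2 fun i =>
      lt_of_le_of_ne (h i (by omega)) (u.injective.ne (by simp [Fin.ext_iff]))
    have := Subsingleton.elim (hm.orderIsoOfSurjective u u.surjective) (OrderIso.refl _)
    ext i
    exact congrArg Fin.val (DFunLike.congr_fun this i)

theorem exists_word_length_eq {m : ℕ} (u : Equiv.Perm (Fin m)) :
    ∃ l, IsWord m l u ∧ l.length = (inversions u).card := by
  induction hc : (inversions u).card generalizing u with
  | zero =>
    refine ⟨[], ⟨by simp, ?_⟩, rfl⟩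
    rw [eq_one_of_no_descent u, List.map_nil, List.prod_nil]
    intro i hi
    by_contra! hlt
    have := card_inversions_mul_sr_of_descent hi u hlt
    omega
  | succ c ih =>
    by_cases hd : ∃ i, ∃ hi : i + 1 < m, u ⟨i + 1, hi⟩ < u ⟨i, by omega⟩
    · obtain ⟨i, hi, hlt⟩ := hd
      have := card_inversions_mul_sr_of_descent hi u hlt
      obtain ⟨l, ⟨hl, hp⟩, hlen⟩ := ih (u * sr m i) (by omega)
      refine ⟨l ++ [i], ⟨?_, ?_⟩, by simp [hlen]⟩
      · intro j hj
        rcases List.mem_append.1 hj with hj | hj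
        · exact hl j hj
        · rwa [List.mem_singleton.1 hj]
      · simp [hp, mul_assoc, sr_mul_self]
    · push Not at hd
      obtain rfl := eq_one_of_no_descent u hd
      simp [inversions_one] at hc

theorem IsWord.of_concat {m i : ℕ} {l : List ℕ} {u : Equiv.Perm (Fin m)}
    (h : IsWord m (l ++ [i]) u) : i + 1 < m ∧ IsWord m l (u * sr m i) := by
  obtain ⟨hl, rfl⟩ := h
  exact ⟨hl i (by simp), fun j hj => hl j (by simp [hj]), by simp [mul_assoc, sr_mul_self]⟩

theorem IsWord.card_inversions_le {m : ℕ} {l : List ℕ} {u : Equiv.Perm (Fin m)}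
    (h : IsWord m l u) : (inversions u).card ≤ l.length := by
  induction l using List.reverseRecOn generalizing u with
  | nil =>
    obtain ⟨-, rfl⟩ := h
    simp [inversions_one]
  | append_singleton l i ih =>
    obtain ⟨hi, hw⟩ := h.of_concat
    have := ih hw
    rw [List.length_append, List.length_singleton]
    rcases lt_or_gt_of_ne (u.injective.ne (a₁ := ⟨i, by omega⟩) (a₂ := ⟨i + 1, hi⟩) (by simp))
      with hlt | hlt
    · have := card_inversions_mul_sr hi u hlt
      omega
    · have := card_inversions_mul_sr_of_descent hi u hlt
      omega

theorem len_eq_card_inversions {m : ℕ} (u : Equiv.Perm (Fin m)) :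
    len u = (inversions u).card := by
  apply le_antisymm
  · exact Nat.sInf_le (exists_word_length_eq u)
  · obtain ⟨l, hl, hlen⟩ := exists_word_length_eq u
    refine le_csInf ⟨_, l, hl, rfl⟩ ?_
    rintro _ ⟨l', hl', rfl⟩
    exact hl'.card_inversions_le

/-- `u` has an inversion straddling the cut between positions `k` and `k + 1`. -/
def CrossesCut {m : ℕ} (u : Equiv.Perm (Fin m)) (k : ℕ) : Prop :=
  ∃ a b : Fin m, (a : ℕ) ≤ k ∧ k < b ∧ u b < u a

theorem sr_le_iff {m i k : ℕ} (hi : i + 1 < m) (hik : i ≠ k) (a : Fin m) :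
    (sr m i a : ℕ) ≤ k ↔ (a : ℕ) ≤ k := by
  rw [val_sr hi]
  split_ifs <;> omega

theorem crossesCut_of_mem_reduced {m k : ℕ} {l : List ℕ} {u : Equiv.Perm (Fin m)}
    (h : IsWord m l u) (hlen : l.length = (inversions u).card) (hk : k ∈ l) :
    CrossesCut u k := by
  induction l using List.reverseRecOn generalizing u with
  | nil => simp at hk
  | append_singleton l i ih =>
    obtain ⟨hi, hw⟩ := h.of_concat
    have hle := hw.card_inversions_le
    rw [List.length_append, List.length_singleton] at hlen
    have hd : u ⟨i + 1, hi⟩ < u ⟨i, by omega⟩ := by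
      refine lt_of_le_of_ne (not_lt.1 fun hlt => ?_) (u.injective.ne (by simp))
      have := card_inversions_mul_sr hi u hlt
      omega
    have hc := card_inversions_mul_sr_of_descent hi u hd
    by_cases hik : i = k
    · subst hik
      exact ⟨_, _, le_rfl, by simp, hd⟩
    · have hkl : k ∈ l := by
        rcases List.mem_append.1 hk with hk | hk
        · exact hk
        · exact absurd (List.mem_singleton.1 hk).symm hik
      obtain ⟨a, b, ha, hb, hab⟩ := ih hw (by omega) hkl
      exact ⟨sr m i a, sr m i b, (sr_le_iff hi hik a).2 ha,
        not_le.1 fun hb' => absurd ((sr_le_iff hi hik b).1 hb') (by omega), hab⟩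

theorem IsWord.le_iff_of_notMem {m k : ℕ} {l : List ℕ} {u : Equiv.Perm (Fin m)}
    (h : IsWord m l u) (hk : k ∉ l) (a : Fin m) : (u a : ℕ) ≤ k ↔ (a : ℕ) ≤ k := by
  induction l using List.reverseRecOn generalizing u a with
  | nil => obtain ⟨-, rfl⟩ := h; simp
  | append_singleton l i ih =>
    obtain ⟨hi, hw⟩ := h.of_concat
    have hik : i ≠ k := by rintro rfl; simp at hk
    have := ih hw (fun hl => hk (by simp [hl])) (sr m i a)
    rwa [Equiv.Perm.mul_apply, sr_sr, sr_le_iff hi hik] at this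

theorem mem_supp_iff {m k : ℕ} (u : Equiv.Perm (Fin m)) : k ∈ supp u ↔ CrossesCut u k := by
  constructor
  · rintro ⟨l, ⟨hw, hlen⟩, hk⟩
    exact crossesCut_of_mem_reduced hw (hlen.trans (len_eq_card_inversions u)) hk
  · rintro ⟨a, b, ha, hb, hab⟩
    obtain ⟨l, hw, hlen⟩ := exists_word_length_eq u
    refine ⟨l, ⟨hw, hlen.trans (len_eq_card_inversions u).symm⟩, ?_⟩
    by_contra hk
    have h₁ := (hw.le_iff_of_notMem hk a).2 ha
    have h₂ := (hw.le_iff_of_notMem hk b).not.2 (by omega)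
    rw [Fin.lt_def] at hab
    omega

section Cuts

variable {m : ℕ} (w : Equiv.Perm (Fin m)) (p : Fin m)

/-- The cuts after a position `K > p` crossed by an inversion lying to the right of `p`. -/
def innerCuts : Finset (Fin m) :=
  {K | p < K ∧ ∃ a b, p < a ∧ a ≤ K ∧ K < b ∧ w b < w a}

/-- The cuts after a position `K > p` that are crossed by an inversion starting to the left
of `p`, but by none lying to the right of `p`. -/
def outerCuts : Finset (Fin m) :=
  {K | p < K ∧ (∃ x b, x < p ∧ K < b ∧ w b < w x) ∧ ∀ a b, p < a → a ≤ K → K < b → w a < w b}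

/-- The inversions lying to the right of `p`. -/
def rightInversions : Finset (Fin m × Fin m) :=
  {q | p < q.1 ∧ q.1 < q.2 ∧ w q.2 < w q.1}

/-- The occurrences `x < a < b` of `312` in which `p` separates `x` from `a`. -/
def splitTriples : Finset (Fin m × Fin m × Fin m) :=
  {q | q.1 < p ∧ p < q.2.1 ∧ q.2.1 < q.2.2 ∧ w q.2.1 < w q.2.2 ∧ w q.2.2 < w q.1}

/-- To the right of `p` there is an occurrence of `321` or of `3412`. -/
def HasRightPattern : Prop :=
  (∃ a b c, p < a ∧ a < b ∧ b < c ∧ w c < w b ∧ w b < w a) ∨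
  (∃ a b c d, p < a ∧ a < b ∧ b < c ∧ c < d ∧ w c < w d ∧ w d < w a ∧ w a < w b)

/-- Some split triple `x, a, b` can be extended by one further entry: by a second entry left of
`p` exceeding `b`, by an entry right of `p` smaller than `x`, or by an entry between `p` and `a`
exceeding `x`. -/
def HasSplitPattern : Prop :=
  (∃ x y a b, x < y ∧ y < p ∧ p < a ∧ a < b ∧ w a < w b ∧ w b < w x ∧ w b < w y) ∨
  (∃ x a b c, x < p ∧ p < a ∧ a < b ∧ p < c ∧ c ≠ a ∧ c ≠ b ∧ w a < w b ∧ w b < w x ∧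
    w c < w x) ∨
  (∃ x y a b, x < p ∧ p < y ∧ y < a ∧ a < b ∧ w a < w b ∧ w b < w x ∧ w x < w y)

/-- The inversion assigned to an inner cut `K`: it starts at `K` and ends at the last smaller
entry, or, if `K` has no smaller entry to its right, it ends at `K` and starts at the largest
entry between `p` and `K`. -/
def InnerRel (K : Fin m) (q : Fin m × Fin m) : Prop :=
  (q.1 = K ∧ ∀ c, q.2 < c → w K < w c) ∨
  (q.2 = K ∧ (∀ c, K < c → w K < w c) ∧ (∀ c, p < c → c ≤ K → w c ≤ w q.1) ∧
    ∃ c, K < c ∧ w c < w q.1)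

/-- The split triple assigned to an outer cut `K`: the largest entry left of `p`, the entry at
`K`, and the smallest entry right of `K`. -/
def OuterRel (K : Fin m) (q : Fin m × Fin m × Fin m) : Prop :=
  q.2.1 = K ∧ (∀ y, y < p → w y ≤ w q.1) ∧ ∀ c, K < c → w q.2.2 ≤ w c

variable {w p}

theorem InnerRel.cut_unique {K K' : Fin m} {q : Fin m × Fin m}
    (h : InnerRel w p K q) (h' : InnerRel w p K' q) : K = K' := by
  rcases h with ⟨rfl, h⟩ | ⟨rfl, -, -, c, hc⟩ <;>
    rcases h' with ⟨rfl, h'⟩ | ⟨rfl, -, -, c', hc'⟩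
  · rfl
  · exact absurd (h c' hc'.1) hc'.2.asymm
  · exact absurd (h' c hc.1) hc.2.asymm
  · rfl

theorem exists_innerRel {K : Fin m} (hK : K ∈ innerCuts w p) :
    ∃ q ∈ rightInversions w p, InnerRel w p K q := by
  simp only [innerCuts, rightInversions, Finset.mem_filter, Finset.mem_univ, true_and] at hK ⊢
  obtain ⟨hpK, a, b, hpa, haK, hKb, hab⟩ := hK
  by_cases hs : ∃ c, K < c ∧ w c < w K
  · obtain ⟨r, hr, hmax⟩ := Finset.exists_max_image
      (Finset.univ.filter fun c => K < c ∧ w c < w K) id (hs.imp fun c hc => by simpa using hc)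
    simp only [Finset.mem_filter, Finset.mem_univ, true_and, id] at hr hmax
    refine ⟨(K, r), ⟨hpK, hr.1, hr.2⟩, Or.inl ⟨rfl, fun c hc => ?_⟩⟩
    by_contra hlt
    have hne : w c ≠ w K := w.injective.ne (hr.1.trans hc).ne'
    exact absurd (hmax c ⟨hr.1.trans hc, lt_of_le_of_ne (not_lt.1 hlt) hne⟩) (not_le.2 hc)
  · push Not at hs
    have hs' : ∀ c, K < c → w K < w c := fun c hc =>
      lt_of_le_of_ne (hs c hc) (w.injective.ne hc.ne)
    obtain ⟨r, hr, hmax⟩ := Finset.exists_max_image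
      (Finset.univ.filter fun c => p < c ∧ c ≤ K) w ⟨K, by simpa using hpK⟩
    simp only [Finset.mem_filter, Finset.mem_univ, true_and] at hr hmax
    have har := hmax a ⟨hpa, haK⟩
    have hKr : w K < w r := (hs' b hKb).trans (hab.trans_le har)
    have hne : r ≠ K := by
      rintro rfl
      exact hKr.false
    exact ⟨(r, K), ⟨hr.1, lt_of_le_of_ne hr.2 hne, hKr⟩,
      Or.inr ⟨rfl, hs', fun c h₁ h₂ => hmax c ⟨h₁, h₂⟩, b, hKb, hab.trans_le har⟩⟩

theorem card_innerCuts_le : (innerCuts w p).card ≤ (rightInversions w p).card :=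
  Finset.card_le_card_of_forall_subsingleton (InnerRel w p) (fun _ => exists_innerRel)
    fun _ _ _ h _ h' => h.2.cut_unique h'.2

theorem card_innerCuts_lt (h : HasRightPattern w p) :
    (innerCuts w p).card < (rightInversions w p).card := by
  obtain ⟨q, hq, hbad⟩ : ∃ q ∈ rightInversions w p, ∀ K, ¬ InnerRel w p K q := by
    simp only [rightInversions, Finset.mem_filter, Finset.mem_univ, true_and]
    rcases h with ⟨a, b, c, hpa, hab, hbc, hcb, hba⟩ | ⟨a, b, c, d, hpa, hab, hbc, hcd, h₁, h₂, h₃⟩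
    · refine ⟨(a, b), ⟨hpa, hab, hba⟩, ?_⟩
      rintro K (⟨rfl, h⟩ | ⟨rfl, h, -⟩)
      · exact absurd (h c hbc) (hcb.trans hba).asymm
      · exact absurd (h c hbc) hcb.asymm
    · refine ⟨(a, c), ⟨hpa, hab.trans hbc, h₁.trans h₂⟩, ?_⟩
      rintro K (⟨rfl, h⟩ | ⟨rfl, -, h, -⟩)
      · exact absurd (h d hcd) h₂.asymm
      · exact absurd (h b (hpa.trans hab) hbc.le) (not_le.2 h₃)
  refine (Finset.card_le_card_of_forall_subsingleton (t := (rightInversions w p).erase q)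
    (InnerRel w p) (fun K hK => ?_) fun _ _ _ h _ h' => h.2.cut_unique h'.2).trans_lt
    (Finset.card_erase_lt_of_mem hq)
  obtain ⟨q', hq', hr⟩ := exists_innerRel hK
  exact ⟨q', Finset.mem_erase.2 ⟨fun h => hbad K (h ▸ hr), hq'⟩, hr⟩

theorem card_innerCuts_eq (h : ¬ HasRightPattern w p) :
    (innerCuts w p).card = (rightInversions w p).card := by
  refine le_antisymm card_innerCuts_le
    (Finset.card_le_card_of_forall_subsingleton (fun q K => InnerRel w p K q) ?_ ?_)
  · rintro ⟨a, b⟩ hq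
    simp only [innerCuts, rightInversions, Finset.mem_filter, Finset.mem_univ, true_and] at hq ⊢
    obtain ⟨hpa, hab, hba⟩ := hq
    have h321 : ∀ x y z, p < x → x < y → y < z → w y < w x → w y < w z := by
      intro x y z hx hxy hyz hlt
      refine lt_of_le_of_ne (not_lt.1 fun hzy => h (Or.inl ⟨x, y, z, hx, hxy, hyz, hzy, hlt⟩))
        (w.injective.ne hyz.ne)
    by_cases hr : ∀ c, b < c → w a < w c
    · exact ⟨a, ⟨hpa, a, b, hpa, le_rfl, hab, hba⟩, Or.inl ⟨rfl, hr⟩⟩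
    · push Not at hr
      obtain ⟨c, hbc, hca⟩ := hr
      have hca' : w c < w a := lt_of_le_of_ne hca (w.injective.ne (hab.trans hbc).ne')
      refine ⟨b, ⟨hpa.trans hab, a, c, hpa, hab.le, hbc, hca'⟩,
        Or.inr ⟨rfl, fun d hd => h321 a b d hpa hab hd hba, fun y hpy hyb => ?_, c, hbc, hca'⟩⟩
      by_contra! hay
      have hyb' : y < b := lt_of_le_of_ne hyb (by rintro rfl; exact hay.asymm hba)
      rcases lt_trichotomy y a with hya | rfl | hya
      · exact absurd (h321 y a b hpy hya hab hay) hba.asymm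
      · exact hay.false
      · exact h (Or.inr ⟨a, y, b, c, hpa, hya, hyb', hbc, h321 a b c hpa hab hbc hba, hca', hay⟩)
  · rintro K - ⟨a, b⟩ ⟨hq, h₁⟩ ⟨a', b'⟩ ⟨hq', h₂⟩
    simp only [rightInversions, Finset.mem_filter, Finset.mem_univ, true_and] at hq hq'
    rcases h₁ with ⟨rfl, h₁⟩ | ⟨rfl, h₁, h₁', -⟩ <;> rcases h₂ with ⟨h₀, h₂⟩ | ⟨h₀, h₂, h₂', -⟩ <;>
      obtain rfl := h₀
    · refine Prod.ext rfl (le_antisymm (not_lt.1 fun hlt => ?_) (not_lt.1 fun hlt => ?_))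
      · exact absurd (h₂ b hlt) hq.2.2.asymm
      · exact absurd (h₁ b' hlt) hq'.2.2.asymm
    · exact absurd (h₂ b hq.2.1) hq.2.2.asymm
    · exact absurd (h₁ b' hq'.2.1) hq'.2.2.asymm
    · exact Prod.ext (w.injective
        (le_antisymm (h₂' a hq.1 hq.2.1.le) (h₁' a' hq'.1 hq'.2.1.le))) rfl

theorem exists_outerRel {K : Fin m} (hK : K ∈ outerCuts w p) :
    ∃ q ∈ splitTriples w p, OuterRel w p K q := by
  simp only [outerCuts, splitTriples, Finset.mem_filter, Finset.mem_univ, true_and] at hK ⊢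
  obtain ⟨hpK, ⟨x, b, hxp, hKb, hbx⟩, hcut⟩ := hK
  obtain ⟨y, hy, hmax⟩ := Finset.exists_max_image
    (Finset.univ.filter fun y => y < p) w ⟨x, by simpa using hxp⟩
  obtain ⟨c, hc, hmin⟩ := Finset.exists_min_image
    (Finset.univ.filter fun c => K < c) w ⟨b, by simpa using hKb⟩
  simp only [Finset.mem_filter, Finset.mem_univ, true_and] at hy hmax hc hmin
  exact ⟨(y, K, c), ⟨hy, hpK, hc, hcut K c hpK le_rfl hc,
    (hmin b hKb).trans_lt (hbx.trans_le (hmax x hxp))⟩, rfl, hmax, hmin⟩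

theorem card_outerCuts_le : (outerCuts w p).card ≤ (splitTriples w p).card :=
  Finset.card_le_card_of_forall_subsingleton (OuterRel w p) (fun _ => exists_outerRel)
    fun _ _ _ h _ h' => h.2.1.symm.trans h'.2.1

theorem exists_not_outerRel (h : HasSplitPattern w p) :
    ∃ q ∈ splitTriples w p, ∀ K ∈ outerCuts w p, ¬ OuterRel w p K q := by
  simp only [outerCuts, splitTriples, Finset.mem_filter, Finset.mem_univ, true_and, OuterRel,
    Prod.exists]
  rcases h with ⟨x, y, a, b, hxy, hyp, hpa, hab, h₁, h₂, h₃⟩ |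
    ⟨x, a, b, c, hxp, hpa, hab, hpc, hca, hcb, h₁, h₂, h₃⟩ |
    ⟨x, y, a, b, hxp, hpy, hya, hab, h₁, h₂, h₃⟩
  · rcases lt_or_gt_of_ne (w.injective.ne hxy.ne) with hlt | hlt
    · exact ⟨x, a, b, ⟨hxy.trans hyp, hpa, hab, h₁, h₂⟩, fun K _ h => not_le.2 hlt (h.2.1 y hyp)⟩
    · exact ⟨y, a, b, ⟨hyp, hpa, hab, h₁, h₃⟩,
        fun K _ h => not_le.2 hlt (h.2.1 x (hxy.trans hyp))⟩
  · rcases lt_or_gt_of_ne hca with hlt | hlt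
    · rcases lt_or_gt_of_ne (w.injective.ne hcb) with hcb' | hcb'
      · refine ⟨x, c, b, ⟨hxp, hpc, hlt.trans hab, hcb', h₂⟩, ?_⟩
        rintro K - ⟨rfl, -, h⟩
        exact not_le.2 h₁ (h a hlt)
      · refine ⟨x, a, b, ⟨hxp, hpa, hab, h₁, h₂⟩, ?_⟩
        rintro K ⟨-, -, h⟩ ⟨rfl, -⟩
        exact hcb'.asymm (h c b hpc hlt.le hab)
    · rcases lt_or_gt_of_ne (w.injective.ne hcb) with hcb' | hcb'
      · refine ⟨x, a, b, ⟨hxp, hpa, hab, h₁, h₂⟩, ?_⟩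
        rintro K - ⟨rfl, -, h⟩
        exact not_le.2 hcb' (h c hlt)
      · refine ⟨x, a, c, ⟨hxp, hpa, hlt, h₁.trans hcb', h₃⟩, ?_⟩
        rintro K - ⟨rfl, -, h⟩
        exact not_le.2 hcb' (h b hab)
  · refine ⟨x, a, b, ⟨hxp, hpy.trans hya, hab, h₁, h₂⟩, ?_⟩
    rintro K ⟨-, -, h⟩ ⟨rfl, -⟩
    exact (h₂.trans h₃).asymm (h y b hpy hya.le hab)

theorem card_outerCuts_lt (h : HasSplitPattern w p) :
    (outerCuts w p).card < (splitTriples w p).card := by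
  obtain ⟨q, hq, hbad⟩ := exists_not_outerRel h
  refine (Finset.card_le_card_of_forall_subsingleton (t := (splitTriples w p).erase q)
    (OuterRel w p) (fun K hK => ?_) fun _ _ _ h _ h' => h.2.1.symm.trans h'.2.1).trans_lt
    (Finset.card_erase_lt_of_mem hq)
  obtain ⟨q', hq', hr⟩ := exists_outerRel hK
  exact ⟨q', Finset.mem_erase.2 ⟨fun h => hbad K hK (h ▸ hr), hq'⟩, hr⟩

theorem card_outerCuts_eq (h : ¬ HasSplitPattern w p) :
    (outerCuts w p).card = (splitTriples w p).card := by
  refine le_antisymm card_outerCuts_le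
    (Finset.card_le_card_of_forall_subsingleton (fun q K => OuterRel w p K q) ?_ ?_)
  · rintro ⟨x, a, b⟩ hq
    simp only [outerCuts, splitTriples, Finset.mem_filter, Finset.mem_univ, true_and] at hq ⊢
    obtain ⟨hxp, hpa, hab, h₁, h₂⟩ := hq
    have hright : ∀ c, p < c → c ≠ a → c ≠ b → w x < w c := fun c hpc hca hcb =>
      lt_of_le_of_ne (not_lt.1 fun hlt =>
        h (Or.inr (Or.inl ⟨x, a, b, c, hxp, hpa, hab, hpc, hca, hcb, h₁, h₂, hlt⟩)))
        (w.injective.ne (hxp.trans hpc).ne)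
    have hfirst : ∀ c, p < c → c ≤ a → c = a := by
      intro c hpc hca
      by_contra hne
      have hlt := lt_of_le_of_ne hca hne
      exact h (Or.inr (Or.inr ⟨x, c, a, b, hxp, hpc, hlt, hab, h₁, h₂,
        hright c hpc hne (hlt.trans hab).ne⟩))
    refine ⟨a, ⟨hpa, ⟨x, b, hxp, hab, h₂⟩, fun c d hpc hca had => ?_⟩, rfl, fun y hy => ?_,
      fun c hc => ?_⟩
    · rw [hfirst c hpc hca]
      by_cases hdb : d = b
      · rwa [hdb]
      · exact (h₁.trans h₂).trans (hright d (hpa.trans had) had.ne' hdb)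
    · by_contra! hlt
      rcases lt_trichotomy x y with hxy | rfl | hxy
      · exact h (Or.inl ⟨x, y, a, b, hxy, hy, hpa, hab, h₁, h₂, h₂.trans hlt⟩)
      · exact hlt.false
      · exact h (Or.inl ⟨y, x, a, b, hxy, hxp, hpa, hab, h₁, h₂.trans hlt, h₂⟩)
    · by_cases hcb : c = b
      · exact (congrArg w hcb).ge
      · exact (h₂.trans (hright c (hpa.trans hc) hc.ne' hcb)).le
  · rintro K - ⟨x, a, b⟩ ⟨hq, rfl, h₁, h₁'⟩ ⟨x', a', b'⟩ ⟨hq', h₀, h₂, h₂'⟩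
    simp only [splitTriples, Finset.mem_filter, Finset.mem_univ, true_and] at hq hq'
    obtain rfl := h₀
    exact Prod.ext (w.injective (le_antisymm (h₂ x hq.1) (h₁ x' hq'.1)))
      (Prod.ext rfl (w.injective (le_antisymm (h₁' b' hq'.2.2.1) (h₂' b hq.2.2.1))))

end Cuts

section TopOccurrences

variable {n : ℕ} (w : Equiv.Perm (Fin (n + 1)))

/-- The position of the largest value. -/
def topPos : Fin (n + 1) := w⁻¹ (Fin.last n)

theorem apply_topPos : w (topPos w) = Fin.last n := by
  simp [topPos]

theorem posOf_last : posOf w n = topPos w := by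
  simp [posOf, topPos, Fin.last]

variable {w}

theorem lt_apply_topPos {a : Fin (n + 1)} (h : a ≠ topPos w) : w a < w (topPos w) := by
  rw [apply_topPos]
  exact lt_of_le_of_ne (Fin.le_last _) fun h' => h (w.injective (h'.trans (apply_topPos w).symm))

theorem val_apply_lt_of_ne {a : Fin (n + 1)} (h : a ≠ topPos w) : (w a : ℕ) < n := by
  simpa only [apply_topPos, Fin.lt_def, Fin.val_last] using lt_apply_topPos h

theorem IsTopOccSet.exists_embedding {c : ℕ} {q : Fin c → ℕ} {S : Finset ℕ}
    (h : IsTopOccSet q w S) (t : Fin c) (ht : ∀ b, b ≠ t → q b < q t) :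
    ∃ f : Fin c → Fin (n + 1), StrictMono f ∧ (∀ a b, q a < q b → w (f a) < w (f b)) ∧
      f t = topPos w ∧ S = Finset.image (fun a => (w (f a) : ℕ)) Finset.univ := by
  obtain ⟨⟨f, hf, hq, rfl⟩, hn⟩ := h
  obtain ⟨b, -, hb⟩ := Finset.mem_image.1 hn
  refine ⟨f, hf, fun a b => (hq a b).1, ?_, rfl⟩
  have hb' : w (f b) = Fin.last n := Fin.ext hb
  have hbt : b = t := by
    by_contra hne
    exact absurd ((hq b t).1 (ht b hne)) (hb' ▸ (Fin.le_last _).not_gt)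
  rw [← hbt]
  exact w.injective (hb'.trans (apply_topPos w).symm)

theorem isTopOccSet_of_embedding {c : ℕ} {q : Fin c → ℕ} (hq : Function.Injective q)
    (f : Fin c → Fin (n + 1)) (hf : StrictMono f) (h : ∀ a b, q a < q b → w (f a) < w (f b))
    (t : Fin c) (ht : f t = topPos w) :
    IsTopOccSet q w (Finset.image (fun a => (w (f a) : ℕ)) Finset.univ) := by
  refine ⟨⟨f, hf, fun a b => ⟨h a b, fun hlt => ?_⟩, rfl⟩, ?_⟩
  · by_contra hge
    rcases (not_lt.1 hge).lt_or_eq with hba | hba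
    · exact (h b a hba).asymm hlt
    · exact (hq hba ▸ hlt).false
  · exact Finset.mem_image.2 ⟨t, Finset.mem_univ _, by rw [ht, apply_topPos, Fin.val_last]⟩

theorem isTopOccSet_p321_iff {S : Finset ℕ} : IsTopOccSet p321 w S ↔
    ∃ q ∈ rightInversions w (topPos w), {n, (w q.1 : ℕ), (w q.2 : ℕ)} = S := by
  simp only [rightInversions, Finset.mem_filter, Finset.mem_univ, true_and, Prod.exists]
  constructor
  · intro h
    obtain ⟨f, hf, hq, ht, rfl⟩ := h.exists_embedding 0 (by decide)
    refine ⟨f 1, f 2, ⟨ht ▸ hf (by decide), hf (by decide), hq 2 1 (by decide)⟩, ?_⟩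
    ext v
    simp [Fin.exists_fin_succ, ht, apply_topPos, eq_comm]
  · rintro ⟨a, b, ⟨hpa, hab, hba⟩, rfl⟩
    have hw := lt_apply_topPos hpa.ne'
    convert isTopOccSet_of_embedding (q := p321) (by decide) ![topPos w, a, b]
      (Fin.strictMono_iff_lt_succ.2 (by simp [Fin.forall_fin_succ, *]))
      (by simp [Fin.forall_fin_succ, p321, hw, hba, hba.trans hw]) 0 rfl using 1
    ext v
    simp [Fin.exists_fin_succ, apply_topPos, eq_comm]

theorem isTopOccSet_p3412_iff {S : Finset ℕ} : IsTopOccSet p3412 w S ↔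
    ∃ q ∈ splitTriples w (topPos w),
      {n, (w q.1 : ℕ), (w q.2.1 : ℕ), (w q.2.2 : ℕ)} = S := by
  simp only [splitTriples, Finset.mem_filter, Finset.mem_univ, true_and, Prod.exists]
  constructor
  · intro h
    obtain ⟨f, hf, hq, ht, rfl⟩ := h.exists_embedding 1 (by decide)
    refine ⟨f 0, f 2, f 3, ⟨ht ▸ hf (by decide), ht ▸ hf (by decide), hf (by decide),
      hq 2 3 (by decide), hq 3 0 (by decide)⟩, ?_⟩
    ext v
    simp [Fin.exists_fin_succ, ht, apply_topPos, eq_comm]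
    tauto
  · rintro ⟨x, a, b, ⟨hxp, hpa, hab, h₁, h₂⟩, rfl⟩
    have hw := lt_apply_topPos hxp.ne
    convert isTopOccSet_of_embedding (q := p3412) (by decide) ![x, topPos w, a, b]
      (Fin.strictMono_iff_lt_succ.2 (by simp [Fin.forall_fin_succ, *]))
      (by simp [Fin.forall_fin_succ, p3412, hw, h₁, h₂, h₁.trans h₂, h₂.trans hw,
        (h₁.trans h₂).trans hw]) 1 rfl using 1
    ext v
    simp [Fin.exists_fin_succ, apply_topPos, eq_comm]
    tauto

theorem topOccCount_p321 : topOccCount p321 w = (rightInversions w (topPos w)).card := by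
  have : {S | IsTopOccSet p321 w S} =
      (fun q : Fin (n + 1) × Fin (n + 1) => ({n, (w q.1 : ℕ), (w q.2 : ℕ)} : Finset ℕ)) ''
        (rightInversions w (topPos w) : Set (Fin (n + 1) × Fin (n + 1))) := by
    ext S
    simpa using isTopOccSet_p321_iff
  rw [topOccCount, this, Set.InjOn.ncard_image, Set.ncard_coe_finset]
  rintro ⟨a, b⟩ hq ⟨a', b'⟩ hq' h
  simp only [rightInversions, Finset.mem_filter, Finset.mem_univ, true_and, Finset.mem_coe,
    Fin.lt_def] at hq hq'
  have hw : (w a : ℕ) < n := val_apply_lt_of_ne (by omega)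
  have hw' : (w a' : ℕ) < n := val_apply_lt_of_ne (by omega)
  simp only [Finset.ext_iff, Finset.mem_insert, Finset.mem_singleton] at h
  have h₁ := h (w a)
  have h₂ := h (w b)
  have h₃ := h (w a')
  have h₄ := h (w b')
  simp only [Prod.mk.injEq, ← w.injective.eq_iff (a := a), ← w.injective.eq_iff (a := b),
    Fin.ext_iff]
  omega

theorem topOccCount_p3412 : topOccCount p3412 w = (splitTriples w (topPos w)).card := by
  have : {S | IsTopOccSet p3412 w S} =
      (fun q : Fin (n + 1) × Fin (n + 1) × Fin (n + 1) =>
        ({n, (w q.1 : ℕ), (w q.2.1 : ℕ), (w q.2.2 : ℕ)} : Finset ℕ)) ''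
        (splitTriples w (topPos w) : Set (Fin (n + 1) × Fin (n + 1) × Fin (n + 1))) := by
    ext S
    simpa using isTopOccSet_p3412_iff
  rw [topOccCount, this, Set.InjOn.ncard_image, Set.ncard_coe_finset]
  rintro ⟨x, a, b⟩ hq ⟨x', a', b'⟩ hq' h
  simp only [splitTriples, Finset.mem_filter, Finset.mem_univ, true_and, Finset.mem_coe,
    Fin.lt_def] at hq hq'
  have hw : (w x : ℕ) < n := val_apply_lt_of_ne (by omega)
  have hw' : (w x' : ℕ) < n := val_apply_lt_of_ne (by omega)
  simp only [Finset.ext_iff, Finset.mem_insert, Finset.mem_singleton] at h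
  have h₁ := h (w x)
  have h₂ := h (w a)
  have h₃ := h (w b)
  have h₄ := h (w x')
  have h₅ := h (w a')
  have h₆ := h (w b')
  simp only [Prod.mk.injEq, ← w.injective.eq_iff (a := x), ← w.injective.eq_iff (a := a),
    ← w.injective.eq_iff (a := b), Fin.ext_iff]
  omega

theorem HasTopPhiOcc.hasPattern (h : HasTopPhiOcc w) :
    HasRightPattern w (topPos w) ∨ HasSplitPattern w (topPos w) := by
  rcases h with ⟨S, h⟩ | ⟨S, h⟩ | ⟨S, h⟩ | ⟨S, h⟩ | ⟨S, h⟩ | ⟨S, h⟩ | ⟨S, h⟩ | ⟨S, h⟩ | ⟨S, h⟩ |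
    ⟨S, h⟩
  · obtain ⟨f, hf, hq, ht, -⟩ := h.exists_embedding 0 (by decide)
    exact Or.inl (Or.inl ⟨f 1, f 2, f 3, ht ▸ hf (by decide), hf (by decide), hf (by decide),
      hq _ _ (by decide), hq _ _ (by decide)⟩)
  · obtain ⟨f, hf, hq, ht, -⟩ := h.exists_embedding 2 (by decide)
    exact Or.inr (Or.inl ⟨f 0, f 1, f 3, f 4, hf (by decide), ht ▸ hf (by decide),
      ht ▸ hf (by decide), hf (by decide), hq _ _ (by decide), hq _ _ (by decide),
      hq _ _ (by decide)⟩)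
  · obtain ⟨f, hf, hq, ht, -⟩ := h.exists_embedding 1 (by decide)
    exact Or.inr (Or.inr (Or.inl ⟨f 0, f 2, f 3, f 4, ht ▸ hf (by decide), ht ▸ hf (by decide),
      hf (by decide), ht ▸ hf (by decide), hf.injective.ne (by decide),
      hf.injective.ne (by decide), hq _ _ (by decide), hq _ _ (by decide), hq _ _ (by decide)⟩))
  · obtain ⟨f, hf, hq, ht, -⟩ := h.exists_embedding 1 (by decide)
    exact Or.inr (Or.inr (Or.inr ⟨f 0, f 2, f 3, f 4, ht ▸ hf (by decide), ht ▸ hf (by decide),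
      hf (by decide), hf (by decide), hq _ _ (by decide), hq _ _ (by decide),
      hq _ _ (by decide)⟩))
  · obtain ⟨f, hf, hq, ht, -⟩ := h.exists_embedding 2 (by decide)
    exact Or.inr (Or.inl ⟨f 0, f 1, f 3, f 4, hf (by decide), ht ▸ hf (by decide),
      ht ▸ hf (by decide), hf (by decide), hq _ _ (by decide), hq _ _ (by decide),
      hq _ _ (by decide)⟩)
  · obtain ⟨f, hf, hq, ht, -⟩ := h.exists_embedding 1 (by decide)
    exact Or.inr (Or.inr (Or.inl ⟨f 0, f 2, f 3, f 4, ht ▸ hf (by decide), ht ▸ hf (by decide),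
      hf (by decide), ht ▸ hf (by decide), hf.injective.ne (by decide),
      hf.injective.ne (by decide), hq _ _ (by decide), hq _ _ (by decide), hq _ _ (by decide)⟩))
  · obtain ⟨f, hf, hq, ht, -⟩ := h.exists_embedding 1 (by decide)
    exact Or.inr (Or.inr (Or.inl ⟨f 0, f 2, f 4, f 3, ht ▸ hf (by decide), ht ▸ hf (by decide),
      hf (by decide), ht ▸ hf (by decide), hf.injective.ne (by decide),
      hf.injective.ne (by decide), hq _ _ (by decide), hq _ _ (by decide), hq _ _ (by decide)⟩))
  · obtain ⟨f, hf, hq, ht, -⟩ := h.exists_embedding 0 (by decide)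
    exact Or.inl (Or.inr ⟨f 1, f 2, f 3, f 4, ht ▸ hf (by decide), hf (by decide),
      hf (by decide), hf (by decide), hq _ _ (by decide), hq _ _ (by decide),
      hq _ _ (by decide)⟩)
  · obtain ⟨f, hf, hq, ht, -⟩ := h.exists_embedding 1 (by decide)
    exact Or.inr (Or.inr (Or.inl ⟨f 0, f 3, f 4, f 2, ht ▸ hf (by decide), ht ▸ hf (by decide),
      hf (by decide), ht ▸ hf (by decide), hf.injective.ne (by decide),
      hf.injective.ne (by decide), hq _ _ (by decide), hq _ _ (by decide), hq _ _ (by decide)⟩))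
  · obtain ⟨f, hf, hq, ht, -⟩ := h.exists_embedding 1 (by decide)
    exact Or.inr (Or.inr (Or.inl ⟨f 0, f 2, f 3, f 4, ht ▸ hf (by decide), ht ▸ hf (by decide),
      hf (by decide), ht ▸ hf (by decide), hf.injective.ne (by decide),
      hf.injective.ne (by decide), hq _ _ (by decide), hq _ _ (by decide), hq _ _ (by decide)⟩))

theorem exists_isTopOccSet_five {q : Fin 5 → ℕ} (hq : Function.Injective q)
    {a b c d e : Fin (n + 1)} (hab : a < b) (hbc : b < c) (hcd : c < d) (hde : d < e)
    (h : ∀ i j, q i < q j → w (![a, b, c, d, e] i) < w (![a, b, c, d, e] j)) (t : Fin 5)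
    (ht : ![a, b, c, d, e] t = topPos w) : ∃ S, IsTopOccSet q w S :=
  ⟨_, isTopOccSet_of_embedding hq _
    (Fin.strictMono_iff_lt_succ.2 (by simp [Fin.forall_fin_succ, *])) h t ht⟩

theorem HasRightPattern.hasTopPhiOcc (h : HasRightPattern w (topPos w)) : HasTopPhiOcc w := by
  unfold HasTopPhiOcc
  rcases h with ⟨a, b, c, hpa, hab, hbc, h₁, h₂⟩ | ⟨a, b, c, d, hpa, hab, hbc, hcd, h₁, h₂, h₃⟩
  · have hw := lt_apply_topPos hpa.ne'
    refine Or.inl ⟨_, isTopOccSet_of_embedding (by decide) ![topPos w, a, b, c]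
      (Fin.strictMono_iff_lt_succ.2 (by simp [Fin.forall_fin_succ, *])) ?_ 0 rfl⟩
    simp [Fin.forall_fin_succ, p4321]
    grind
  · have hw := lt_apply_topPos (hpa.trans hab).ne'
    have : ∃ S, IsTopOccSet p53412 w S := by
      refine exists_isTopOccSet_five (by decide) hpa hab hbc hcd ?_ 0 rfl
      simp [Fin.forall_fin_succ, p53412]
      grind
    simp only [this, true_or, or_true]

theorem HasSplitPattern.hasTopPhiOcc (h : HasSplitPattern w (topPos w)) : HasTopPhiOcc w := by
  unfold HasTopPhiOcc
  rcases h with ⟨x, y, a, b, hxy, hyp, hpa, hab, h₁, h₂, h₃⟩ |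
    ⟨x, a, b, c, hxp, hpa, hab, hpc, hca, hcb, h₁, h₂, h₃⟩ |
    ⟨x, y, a, b, hxp, hpy, hya, hab, h₁, h₂, h₃⟩
  · have hwx := lt_apply_topPos (hxy.trans hyp).ne
    have hwy := lt_apply_topPos hyp.ne
    rcases lt_or_gt_of_ne (w.injective.ne hxy.ne) with hlt | hlt
    · have : ∃ S, IsTopOccSet p34512 w S := by
        refine exists_isTopOccSet_five (by decide) hxy hyp hpa hab ?_ 2 rfl
        simp [Fin.forall_fin_succ, p34512]
        grind
      simp only [this, true_or, or_true]
    · have : ∃ S, IsTopOccSet p43512 w S := by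
        refine exists_isTopOccSet_five (by decide) hxy hyp hpa hab ?_ 2 rfl
        simp [Fin.forall_fin_succ, p43512]
        grind
      simp only [this, true_or, or_true]
  · have hwx := lt_apply_topPos hxp.ne
    rcases lt_or_gt_of_ne hca with hca | hca
    · rcases lt_or_gt_of_ne (w.injective.ne hcb) with hcb' | hcb'
      · rcases lt_or_gt_of_ne (w.injective.ne hca.ne) with hca' | hca'
        · have : ∃ S, IsTopOccSet p45123 w S := by
            refine exists_isTopOccSet_five (by decide) hxp hpc hca hab ?_ 1 rfl
            simp [Fin.forall_fin_succ, p45123]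
            grind
          simp only [this, true_or, or_true]
        · have : ∃ S, IsTopOccSet p45213 w S := by
            refine exists_isTopOccSet_five (by decide) hxp hpc hca hab ?_ 1 rfl
            simp [Fin.forall_fin_succ, p45213]
            grind
          simp only [this, true_or, or_true]
      · have : ∃ S, IsTopOccSet p45312 w S := by
          refine exists_isTopOccSet_five (by decide) hxp hpc hca hab ?_ 1 rfl
          simp [Fin.forall_fin_succ, p45312]
          grind
        simp only [this, true_or, or_true]
    · rcases lt_or_gt_of_ne hcb with hcb | hcb
      · rcases lt_or_gt_of_ne (w.injective.ne hcb.ne) with hcb' | hcb'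
        · rcases lt_or_gt_of_ne (w.injective.ne hca.ne') with hca' | hca'
          · have : ∃ S, IsTopOccSet p45213 w S := by
              refine exists_isTopOccSet_five (by decide) hxp hpa hca hcb ?_ 1 rfl
              simp [Fin.forall_fin_succ, p45213]
              grind
            simp only [this, true_or, or_true]
          · have : ∃ S, IsTopOccSet p45123 w S := by
              refine exists_isTopOccSet_five (by decide) hxp hpa hca hcb ?_ 1 rfl
              simp [Fin.forall_fin_succ, p45123]
              grind
            simp only [this, true_or, or_true]
        · have : ∃ S, IsTopOccSet p45132 w S := by
            refine exists_isTopOccSet_five (by decide) hxp hpa hca hcb ?_ 1 rfl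
            simp [Fin.forall_fin_succ, p45132]
            grind
          simp only [this, true_or, or_true]
      · rcases lt_or_gt_of_ne (w.injective.ne hcb.ne') with hcb' | hcb'
        · rcases lt_or_gt_of_ne (w.injective.ne hca.ne') with hca' | hca'
          · have : ∃ S, IsTopOccSet p45231 w S := by
              refine exists_isTopOccSet_five (by decide) hxp hpa hab hcb ?_ 1 rfl
              simp [Fin.forall_fin_succ, p45231]
              grind
            simp only [this, or_true]
          · have : ∃ S, IsTopOccSet p45132 w S := by
              refine exists_isTopOccSet_five (by decide) hxp hpa hab hcb ?_ 1 rfl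
              simp [Fin.forall_fin_succ, p45132]
              grind
            simp only [this, true_or, or_true]
        · have : ∃ S, IsTopOccSet p45123 w S := by
            refine exists_isTopOccSet_five (by decide) hxp hpa hab hcb ?_ 1 rfl
            simp [Fin.forall_fin_succ, p45123]
            grind
          simp only [this, true_or, or_true]
  · have hwy := lt_apply_topPos hpy.ne'
    have : ∃ S, IsTopOccSet p35412 w S := by
      refine exists_isTopOccSet_five (by decide) hxp hpy hya hab ?_ 1 rfl
      simp [Fin.forall_fin_succ, p35412]
      grind
    simp only [this, true_or, or_true]

end TopOccurrences

theorem IsDeletion.apply_succAbove {n : ℕ} {w : Equiv.Perm (Fin (n + 1))}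
    {wbar : Equiv.Perm (Fin n)} (h : IsDeletion w wbar) (i : Fin n) :
    (w ((topPos w).succAbove i) : ℕ) = wbar i := by
  rw [h i, posOf_last, Fin.succAbove]
  simp only [Fin.lt_def, Fin.val_castSucc, valAt]
  split_ifs <;> first | rfl | omega

theorem ncard_newrep {n : ℕ} {w : Equiv.Perm (Fin (n + 1))} {wbar : Equiv.Perm (Fin n)}
    (h : IsDeletion w wbar) : (newrep w wbar).ncard =
      (innerCuts w (topPos w)).card + (outerCuts w (topPos w)).card := by
  have hval : ∀ i : Fin n, ((topPos w).succAbove i : ℕ) =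
      if (i : ℕ) < topPos w then (i : ℕ) else i + 1 := by
    intro i
    rw [Fin.succAbove]
    simp only [Fin.lt_def, Fin.val_castSucc]
    split_ifs <;> simp
  have hdisj : Disjoint (innerCuts w (topPos w)) (outerCuts w (topPos w)) := by
    rw [Finset.disjoint_left]
    simp only [innerCuts, outerCuts, Finset.mem_filter, Finset.mem_univ, true_and]
    rintro K ⟨-, a, b, hpa, haK, hKb, hba⟩ ⟨-, -, hcut⟩
    exact hba.asymm (hcut a b hpa haK hKb)
  have hmem : ∀ K, K ∈ innerCuts w (topPos w) ∪ outerCuts w (topPos w) ↔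
      topPos w < K ∧ ∃ a b, a ≠ topPos w ∧ a ≤ K ∧ K < b ∧ w b < w a := by
    intro K
    simp only [innerCuts, outerCuts, Finset.mem_union, Finset.mem_filter, Finset.mem_univ,
      true_and]
    constructor
    · rintro (⟨hpK, a, b, hpa, haK, hKb, hba⟩ | ⟨hpK, ⟨x, b, hxp, hKb, hbx⟩, -⟩)
      · exact ⟨hpK, a, b, hpa.ne', haK, hKb, hba⟩
      · exact ⟨hpK, x, b, hxp.ne, (hxp.trans hpK).le, hKb, hbx⟩
    · rintro ⟨hpK, a, b, hap, haK, hKb, hba⟩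
      by_cases hin : ∃ a b, topPos w < a ∧ a ≤ K ∧ K < b ∧ w b < w a
      · exact Or.inl ⟨hpK, hin⟩
      · refine Or.inr ⟨hpK, ⟨a, b, ?_, hKb, hba⟩, fun c d hpc hcK hKd => ?_⟩
        · exact lt_of_le_of_ne (not_lt.1 fun hpa => hin ⟨a, b, hpa, haK, hKb, hba⟩) hap
        · exact lt_of_le_of_ne (not_lt.1 fun hdc => hin ⟨c, d, hpc, hcK, hKd, hdc⟩)
            (w.injective.ne (hcK.trans_lt hKd).ne)
  rw [← Finset.card_union_of_disjoint hdisj, ← Set.ncard_coe_finset,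
    ← Set.InjOn.ncard_image (f := fun K : Fin (n + 1) => (K : ℕ) - 1)]
  · congr 1
    ext k
    simp only [newrep, mem_supp_iff, CrossesCut, posOf_last, Set.mem_ofPred_eq, Set.mem_image,
      Finset.mem_coe, hmem]
    constructor
    · rintro ⟨⟨a, b, hak, hkb, hba⟩, hpk⟩
      refine ⟨⟨k + 1, by omega⟩, ⟨Fin.lt_def.2 (by simp; omega), (topPos w).succAbove a,
        (topPos w).succAbove b, Fin.succAbove_ne _ _, Fin.le_def.2 ?_, Fin.lt_def.2 ?_,
        Fin.lt_def.2 ?_⟩, by simp⟩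
      · rw [hval]
        simp only
        split_ifs <;> omega
      · rw [hval]
        simp only
        split_ifs <;> omega
      · rwa [h.apply_succAbove, h.apply_succAbove]
    · rintro ⟨K, ⟨hpK, a, b, hap, haK, hKb, hba⟩, rfl⟩
      obtain ⟨i, rfl⟩ := Fin.exists_succAbove_eq hap
      obtain ⟨j, rfl⟩ := Fin.exists_succAbove_eq (hpK.trans hKb).ne'
      rw [Fin.lt_def, h.apply_succAbove, h.apply_succAbove] at hba
      rw [Fin.lt_def] at hpK
      rw [Fin.le_def, hval] at haK
      rw [Fin.lt_def, hval] at hKb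
      refine ⟨⟨i, j, ?_, ?_, hba⟩, by omega⟩
      · split_ifs at haK <;> omega
      · split_ifs at hKb <;> omega
  · intro K hK K' hK' hKK'
    have h₁ := Fin.lt_def.1 ((hmem K).1 hK).1
    have h₂ := Fin.lt_def.1 ((hmem K').1 hK').1
    simp only at hKK'
    exact Fin.ext (by omega)

/-- if `w` has no `N`-occurrence of any pattern in `Φ`, then
`|newrep(w)| = [321;3412]_N(w)`; otherwise `|newrep(w)| < [321;3412]_N(w)`. -/
theorem newrep_card_vs_top_count {n : ℕ} (w : Equiv.Perm (Fin (n + 1)))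
    (wbar : Equiv.Perm (Fin n)) (hdel : IsDeletion w wbar) :
    (¬ HasTopPhiOcc w → (newrep w wbar).ncard = topOccCount p321 w + topOccCount p3412 w) ∧
    (HasTopPhiOcc w → (newrep w wbar).ncard < topOccCount p321 w + topOccCount p3412 w) := by
  rw [ncard_newrep hdel, topOccCount_p321, topOccCount_p3412]
  refine ⟨fun h => ?_, fun h => ?_⟩
  · rw [card_innerCuts_eq fun hr => h hr.hasTopPhiOcc,
      card_outerCuts_eq fun hs => h hs.hasTopPhiOcc]
  · rcases h.hasPattern with hr | hs
    · exact add_lt_add_of_lt_of_le (card_innerCuts_lt hr) card_outerCuts_le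
    · exact add_lt_add_of_le_of_lt card_innerCuts_le (card_outerCuts_lt hs)
end
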